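/- arXiv:2005.11166 — 2 statements merged into one kernel-verified Lean document; each statement's English description precedes it below -/
import Mathlib

section
/- The matrix elements of the characteristic function W(z^{-1}) of the Volterra operator Ĩ are entire functions of zero order. Concretely: for each α, β ∈ {1,2}, the power series F_{αβ}(z) = ∑_{n=0}^{∞} ⟨Ĩⁿ h_α, h_β⟩ zⁿ (which for small |z| equals ⟨(E − zĨ)^{-1} h_α, h_β⟩) converges for every z ∈ ℂ, and for every ε > 0 there exists C > 0 such that |F_{αβ}(z)| ≤ C·exp(|z|^ε) for all z ∈ ℂ. -/
open MeasureTheory Complex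

noncomputable section

variable (p : ℕ) [Fact p.Prime] [MeasurableSpace ℚ_[p]] [BorelSpace ℚ_[p]]

/-- The Volterra operator `Ĩ`:
`(Ĩu)(x) = ((1-p)/(p·log p)) ∫_{‖y‖<‖x‖} (log‖x‖ - log‖y‖) u(y) dμ(y)`. -/
def Ivol (μ : Measure ℚ_[p]) (u : ℚ_[p] → ℂ) (x : ℚ_[p]) : ℂ :=
  (((1 - (p : ℝ)) / ((p : ℝ) * Real.log p) : ℝ) : ℂ) *
    ∫ y in {y : ℚ_[p] | ‖y‖ < ‖x‖},
      ((Real.log ‖x‖ - Real.log ‖y‖ : ℝ) : ℂ) * u y ∂μ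

/-- The pair of functions `h_1 = (p−1)/(i·p·log p)` (constant) and `h_2(x) = −log‖x‖`
appearing in the decomposition of the imaginary part of `Ĩ`. -/
def hFun (a : Fin 2) : ℚ_[p] → ℂ :=
  if a = 0 then fun _ => ((p : ℂ) - 1) / (Complex.I * (p : ℂ) * (Real.log p : ℂ))
  else fun x => -((Real.log ‖x‖ : ℝ) : ℂ)

open Filter Topology in
/-- A power series with coefficients `O(D ^ n * r ^ (n * (n - 1) / 2))`, where `r < 1`, converges
everywhere and defines a function of order zero. -/
theorem summable_and_zero_order_of_norm_le {c : ℕ → ℂ} {A : ℕ → ℝ} {D r : ℝ} (hD : 0 < D)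
    (hr0 : 0 < r) (hr1 : r < 1) (hA0 : 0 < A 0) (hA : ∀ n, A (n + 1) = A n * (D * r ^ n))
    (hc : ∀ n, ‖c n‖ ≤ A n) :
    (∀ z : ℂ, Summable fun n => c n * z ^ n) ∧
      ∀ ε : ℝ, 0 < ε → ∃ C : ℝ, 0 < C ∧ ∀ z : ℂ,
        ‖∑' n, c n * z ^ n‖ ≤ C * Real.exp (‖z‖ ^ ε) := by
  have hApos : ∀ n, 0 < A n := by
    intro n
    induction n with
    | zero => exact hA0
    | succ n ih => rw [hA]; positivity
  have hfac : ∀ N n : ℕ, (((N * (n + 1)).factorial : ℕ) : ℝ)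
      ≤ ((N * n).factorial : ℕ) * ((N * (n + 1) : ℕ) : ℝ) ^ N := by
    intro N n
    have h : (N * (n + 1)).factorial ≤ (N * n).factorial * (N * (n + 1)) ^ N := by
      have := Nat.factorial_mul_ascFactorial (N * n) N
      rw [mul_add_one, ← this]
      gcongr
      exact Nat.ascFactorial_le_pow_add (N * n) N
    exact_mod_cast h
  have hsum : ∀ N : ℕ, 0 < N → Summable fun n => A n * ((N * n).factorial : ℝ) := by
    intro N hN
    have hlim : Tendsto (fun n : ℕ => D * r ^ n * ((N * (n + 1) : ℕ) : ℝ) ^ N) atTop (𝓝 0) := by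
      have h := (tendsto_pow_const_mul_const_pow_of_abs_lt_one N
        (show |r| < 1 by rwa [abs_of_pos hr0])).comp (tendsto_add_atTop_nat 1)
      have h' := h.const_mul (D * N ^ N * r⁻¹)
      rw [mul_zero] at h'
      refine h'.congr fun n => ?_
      simp only [Function.comp]
      push_cast
      rw [mul_pow, pow_succ r]
      field_simp
    refine summable_of_ratio_norm_eventually_le (r := 1 / 2) (by norm_num) ?_
    filter_upwards [hlim.eventually_le_const (show (0 : ℝ) < 1 / 2 by norm_num)] with n hn
    have h1 := hApos n
    have h2 := hApos (n + 1)
    rw [Real.norm_of_nonneg (by positivity), Real.norm_of_nonneg (by positivity), hA]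
    calc A n * (D * r ^ n) * ((N * (n + 1)).factorial : ℝ)
        ≤ A n * (D * r ^ n) * (((N * n).factorial : ℕ) * ((N * (n + 1) : ℕ) : ℝ) ^ N) := by
          gcongr
          exact hfac N n
      _ = (D * r ^ n * ((N * (n + 1) : ℕ) : ℝ) ^ N) * (A n * ((N * n).factorial : ℝ)) := by ring
      _ ≤ _ := by gcongr
  have hpow : ∀ (ε : ℝ) (N : ℕ), 0 < ε → 1 / ε ≤ N → ∀ (T : ℝ) (n : ℕ), 0 ≤ T →
      T ^ n ≤ ((N * n).factorial : ℝ) * Real.exp (T ^ ε) := by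
    intro ε N hε hN T n hT
    have hexp := Real.pow_div_factorial_le_exp (T ^ ε) (by positivity) (N * n)
    have hfpos : (0 : ℝ) < ((N * n).factorial : ℝ) := by positivity
    rw [div_le_iff₀ hfpos, mul_comm (Real.exp _)] at hexp
    rcases le_total T 1 with h | h
    · calc T ^ n ≤ 1 := pow_le_one₀ hT h
        _ ≤ 1 * 1 := by norm_num
        _ ≤ _ := by
          gcongr
          · exact_mod_cast Nat.succ_le_of_lt (Nat.factorial_pos _)
          · exact Real.one_le_exp (by positivity)
    · refine le_trans ?_ hexp
      rw [← Real.rpow_natCast, ← Real.rpow_natCast, ← Real.rpow_mul hT]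
      refine Real.rpow_le_rpow_of_exponent_le h ?_
      rw [div_le_iff₀ hε] at hN
      push_cast
      nlinarith [(Nat.cast_nonneg n : (0 : ℝ) ≤ n)]
  have hterm : ∀ (ε : ℝ) (N : ℕ), 0 < ε → 1 / ε ≤ N → ∀ (z : ℂ) (n : ℕ),
      ‖c n * z ^ n‖ ≤ A n * ((N * n).factorial : ℝ) * Real.exp (‖z‖ ^ ε) := by
    intro ε N hε hN z n
    rw [norm_mul, norm_pow, mul_assoc]
    exact mul_le_mul (hc n) (hpow ε N hε hN _ n (norm_nonneg z)) (by positivity) (hApos n).le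
  refine ⟨fun z => ?_, fun ε hε => ?_⟩
  · exact Summable.of_norm_bounded ((hsum 1 one_pos).mul_right _)
      (hterm 1 1 one_pos (by norm_num) z)
  · obtain ⟨N, hN⟩ := exists_nat_ge (1 / ε)
    have hN0 : 0 < N := by
      have : (0 : ℝ) < N := lt_of_lt_of_le (by positivity) hN
      exact_mod_cast this
    refine ⟨∑' n, A n * ((N * n).factorial : ℝ), ?_, fun z => ?_⟩
    · exact (hsum N hN0).tsum_pos (fun n => by have := hApos n; positivity) 0
        (by have := hApos 0; positivity)
    · exact tsum_of_norm_bounded ((hsum N hN0).hasSum.mul_right _) (hterm ε N hε hN z)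

section Padic

variable {p : ℕ} [Fact p.Prime]

theorem one_lt_natCast_prime : (1 : ℝ) < p := mod_cast (Fact.out : p.Prime).one_lt

theorem Padic.exists_norm_eq_inv_pow {x : ℚ_[p]} (hx0 : x ≠ 0) (hx : ‖x‖ ≤ 1) :
    ∃ k : ℕ, ‖x‖ = ((p : ℝ)⁻¹) ^ k := by
  have h := Padic.norm_eq_zpow_neg_valuation hx0
  have hv : 0 ≤ x.valuation := Padic.norm_le_one_iff_val_nonneg x |>.1 hx
  lift x.valuation to ℕ using hv with k
  exact ⟨k, by rw [h]; simp⟩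

theorem Padic.norm_le_inv_mul_of_norm_lt {x y : ℚ_[p]} (h : ‖y‖ < ‖x‖) :
    ‖y‖ ≤ (p : ℝ)⁻¹ * ‖x‖ := by
  have hx : x ≠ 0 := norm_pos_iff.1 ((norm_nonneg y).trans_lt h)
  have hp : (p : ℝ) ≠ 0 := by have := one_lt_natCast_prime (p := p); positivity
  rw [Padic.norm_eq_zpow_neg_valuation hx] at h ⊢
  have := (Padic.norm_le_pow_iff_norm_lt_pow_add_one y (-x.valuation - 1)).2 (by simpa using h)
  rwa [zpow_sub_one₀ hp, mul_comm] at this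

theorem exists_norm_hFun_le (a : Fin 2) : ∃ M : ℝ, 0 < M ∧ ∀ y : ℚ_[p], y ≠ 0 → ‖y‖ ≤ 1 →
    ‖hFun p a y‖ ≤ M * ‖y‖ ^ (-1 / 4 : ℝ) := by
  have hone : ∀ y : ℚ_[p], y ≠ 0 → ‖y‖ ≤ 1 → 1 ≤ ‖y‖ ^ (-1 / 4 : ℝ) := fun y hy0 hy =>
    Real.one_le_rpow_of_pos_of_le_one_of_nonpos (norm_pos_iff.2 hy0) hy (by norm_num)
  by_cases ha : a = 0
  · refine ⟨‖((p : ℂ) - 1) / (Complex.I * (p : ℂ) * (Real.log p : ℂ))‖ + 1, by positivity,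
      fun y hy0 hy => ?_⟩
    have h := hone y hy0 hy
    simp only [hFun, ha, if_true]
    nlinarith [norm_nonneg (((p : ℂ) - 1) / (Complex.I * (p : ℂ) * (Real.log p : ℂ)))]
  · refine ⟨4, by norm_num, fun y hy0 hy => ?_⟩
    have hypos : 0 < ‖y‖ := norm_pos_iff.2 hy0
    simp only [hFun, ha, if_false]
    rw [norm_neg, Complex.norm_real, Real.norm_of_nonpos (Real.log_nonpos hypos.le hy),
      ← Real.log_inv]
    refine (Real.log_le_rpow_div (by positivity) (show (0 : ℝ) < 1 / 4 by norm_num)).trans ?_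
    rw [Real.inv_rpow hypos.le, ← Real.rpow_neg hypos.le]
    apply le_of_eq
    rw [show (-1 / 4 : ℝ) = -(1 / 4) by norm_num]
    ring

variable [MeasurableSpace ℚ_[p]] [BorelSpace ℚ_[p]]

theorem measurableSet_norm_le (r : ℝ) : MeasurableSet {x : ℚ_[p] | ‖x‖ ≤ r} :=
  (isClosed_le continuous_norm continuous_const).measurableSet

variable (μ : Measure ℚ_[p]) [μ.IsAddHaarMeasure]

theorem measure_norm_le_inv_pow_succ (k : ℕ) :
    p * μ {x : ℚ_[p] | ‖x‖ ≤ ((p : ℝ)⁻¹) ^ (k + 1)} ≤ μ {x : ℚ_[p] | ‖x‖ ≤ ((p : ℝ)⁻¹) ^ k} := by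
  have hp1 := one_lt_natCast_prime (p := p)
  have hq : 0 < (p : ℝ)⁻¹ := by positivity
  set B : Set ℚ_[p] := {x | ‖x‖ ≤ ((p : ℝ)⁻¹) ^ (k + 1)} with hB
  let S : Fin p → Set ℚ_[p] := fun i => (fun x => -((i : ℕ) * (p : ℚ_[p]) ^ k) + x) ⁻¹' B
  have hS : ∀ i, μ (S i) = μ B := fun i => measure_preimage_add μ _ B
  have hmeas : ∀ i, MeasurableSet (S i) := fun i =>
    (measurable_const_add _) (measurableSet_norm_le _)
  have hnp : ‖(p : ℚ_[p])‖ = (p : ℝ)⁻¹ := Padic.norm_p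
  have hdisj : Pairwise (Function.onFun Disjoint S) := by
    intro i j hij
    refine Set.disjoint_left.2 fun x hi hj => hij ?_
    simp only [S, B, Set.mem_preimage, Set.mem_ofPred_eq] at hi hj
    have h := (IsUltrametricDist.norm_add_le_max _ _).trans (max_le hi ((norm_neg _).trans_le hj))
    rw [← sub_eq_add_neg] at h
    have he : -((i : ℕ) * (p : ℚ_[p]) ^ k) + x - (-((j : ℕ) * (p : ℚ_[p]) ^ k) + x)
        = (((j : ℕ) - (i : ℕ) : ℤ) : ℚ_[p]) * (p : ℚ_[p]) ^ k := by push_cast; ring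
    rw [he, norm_mul, norm_pow, hnp, pow_succ', mul_le_mul_iff_left₀ (by positivity)] at h
    have hlt := (Padic.norm_intCast_lt_one_iff).1 (h.trans_lt (inv_lt_one_of_one_lt₀ hp1))
    have hi' := i.2
    have hj' := j.2
    have := Int.eq_zero_of_abs_lt_dvd hlt (by rw [abs_lt]; omega)
    ext
    omega
  have hsub : ⋃ i, S i ⊆ {x : ℚ_[p] | ‖x‖ ≤ ((p : ℝ)⁻¹) ^ k} := by
    refine Set.iUnion_subset fun i x hx => ?_
    simp only [S, B, Set.mem_preimage, Set.mem_ofPred_eq] at hx ⊢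
    have he : x = (-((i : ℕ) * (p : ℚ_[p]) ^ k) + x) + (i : ℕ) * (p : ℚ_[p]) ^ k := by ring
    rw [he]
    refine (IsUltrametricDist.norm_add_le_max _ _).trans (max_le (hx.trans ?_) ?_)
    · exact pow_le_pow_of_le_one hq.le (inv_le_one_of_one_le₀ hp1.le) (Nat.le_succ k)
    · rw [norm_mul, norm_pow, hnp]
      have : ‖((i : ℕ) : ℚ_[p])‖ ≤ 1 := mod_cast Padic.norm_int_le_one (p := p) ((i : ℕ) : ℤ)
      exact mul_le_of_le_one_left (by positivity) this
  calc p * μ B = ∑ i : Fin p, μ (S i) := by simp [hS]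
    _ = μ (⋃ i, S i) := by rw [measure_iUnion hdisj hmeas, tsum_fintype]
    _ ≤ _ := measure_mono hsub

variable {μ}

theorem measure_norm_le_inv_pow (hμ : μ {x : ℚ_[p] | ‖x‖ ≤ 1} = 1) (k : ℕ) :
    μ {x : ℚ_[p] | ‖x‖ ≤ ((p : ℝ)⁻¹) ^ k} ≤ ENNReal.ofReal (((p : ℝ)⁻¹) ^ k) := by
  have hp1 := one_lt_natCast_prime (p := p)
  induction k with
  | zero => simp [hμ]
  | succ k ih =>
    have h := (measure_norm_le_inv_pow_succ μ k).trans ih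
    have hp0 : (p : ENNReal) ≠ 0 := by exact_mod_cast (Fact.out : p.Prime).ne_zero
    rw [mul_comm, ← ENNReal.le_div_iff_mul_le (Or.inl hp0) (Or.inl (by simp))] at h
    refine h.trans (le_of_eq ?_)
    rw [pow_succ, ← div_eq_mul_inv, ENNReal.ofReal_div_of_pos (by positivity),
      ENNReal.ofReal_natCast]

theorem integrableOn_norm_rpow (hμ : μ {x : ℚ_[p] | ‖x‖ ≤ 1} = 1) :
    IntegrableOn (fun x : ℚ_[p] => ‖x‖ ^ (-1 / 2 : ℝ)) {x | ‖x‖ ≤ 1} μ := by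
  have hp1 := one_lt_natCast_prime (p := p)
  refine ⟨(measurable_norm.pow_const _).aestronglyMeasurable, ?_⟩
  rw [hasFiniteIntegral_iff_ofReal (ae_of_all _ fun x => by positivity)]
  set S : ℕ → Set ℚ_[p] := fun k => {x | ‖x‖ = ((p : ℝ)⁻¹) ^ k}
  have hS : ∀ k, MeasurableSet (S k) := fun k =>
    (isClosed_eq continuous_norm continuous_const).measurableSet
  have hsub : {x : ℚ_[p] | ‖x‖ ≤ 1} ⊆ {0} ∪ ⋃ k, S k := by
    intro x hx
    rcases eq_or_ne x 0 with h | h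
    · exact Or.inl h
    · exact Or.inr (Set.mem_iUnion.2 (Padic.exists_norm_eq_inv_pow h hx))
  set r : ℝ := (p : ℝ)⁻¹ ^ (1 / 2 : ℝ)
  have hr1 : r < 1 := Real.rpow_lt_one (by positivity) (inv_lt_one_of_one_lt₀ hp1) (by norm_num)
  have hshell : ∀ k, ∫⁻ x in S k, ENNReal.ofReal (‖x‖ ^ (-1 / 2 : ℝ)) ∂μ
      ≤ ENNReal.ofReal (r ^ k) := by
    intro k
    have hk : 0 < ((p : ℝ)⁻¹) ^ k := by positivity
    calc ∫⁻ x in S k, ENNReal.ofReal (‖x‖ ^ (-1 / 2 : ℝ)) ∂μ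
        = ∫⁻ _ in S k, ENNReal.ofReal ((((p : ℝ)⁻¹) ^ k) ^ (-1 / 2 : ℝ)) ∂μ :=
          setLIntegral_congr_fun (hS k) fun x hx => by
            simp only [S, Set.mem_ofPred_eq] at hx
            simp only [hx]
      _ = ENNReal.ofReal ((((p : ℝ)⁻¹) ^ k) ^ (-1 / 2 : ℝ)) * μ (S k) := by
          rw [setLIntegral_const]
      _ ≤ ENNReal.ofReal ((((p : ℝ)⁻¹) ^ k) ^ (-1 / 2 : ℝ)) *
            ENNReal.ofReal (((p : ℝ)⁻¹) ^ k) := by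
          gcongr
          exact (measure_mono fun x hx => le_of_eq hx).trans (measure_norm_le_inv_pow hμ k)
      _ = ENNReal.ofReal (r ^ k) := by
          rw [← ENNReal.ofReal_mul (by positivity)]
          congr 1
          nth_rewrite 2 [← Real.rpow_one (((p : ℝ)⁻¹) ^ k)]
          rw [← Real.rpow_add hk, Real.rpow_pow_comm (by positivity)]
          norm_num
  have hsumm : Summable fun k : ℕ => r ^ k :=
    summable_geometric_of_lt_one (by positivity) hr1
  calc ∫⁻ x in {x : ℚ_[p] | ‖x‖ ≤ 1}, ENNReal.ofReal (‖x‖ ^ (-1 / 2 : ℝ)) ∂μ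
      ≤ ∫⁻ x in {0} ∪ ⋃ k, S k, ENNReal.ofReal (‖x‖ ^ (-1 / 2 : ℝ)) ∂μ :=
        lintegral_mono_set hsub
    _ ≤ ∫⁻ x in {0}, ENNReal.ofReal (‖x‖ ^ (-1 / 2 : ℝ)) ∂μ +
          ∫⁻ x in ⋃ k, S k, ENNReal.ofReal (‖x‖ ^ (-1 / 2 : ℝ)) ∂μ := lintegral_union_le _ _ _
    _ ≤ 0 + ∑' k, ENNReal.ofReal (r ^ k) := by
        gcongr
        · simp
        · exact (lintegral_iUnion_le _ _).trans (ENNReal.tsum_le_tsum hshell)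
    _ < ⊤ := by
        rw [zero_add]
        exact hsumm.tsum_ofReal_lt_top

theorem norm_setIntegral_le_mul_integral_norm_rpow (hμ : μ {x : ℚ_[p] | ‖x‖ ≤ 1} = 1)
    {f : ℚ_[p] → ℂ} {K : ℝ} (hK : 0 ≤ K) {S : Set ℚ_[p]} (hS : MeasurableSet S)
    (hS1 : S ⊆ {x | ‖x‖ ≤ 1}) (hf : ∀ y ∈ S, y ≠ 0 → ‖f y‖ ≤ K * ‖y‖ ^ (-1 / 2 : ℝ)) :
    ‖∫ y in S, f y ∂μ‖ ≤ K * ∫ y in {y : ℚ_[p] | ‖y‖ ≤ 1}, ‖y‖ ^ (-1 / 2 : ℝ) ∂μ := by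
  have hint := integrableOn_norm_rpow hμ
  have h0 : ∀ᵐ y ∂μ.restrict S, y ≠ 0 := ae_restrict_of_ae (Measure.ae_ne μ 0)
  calc ‖∫ y in S, f y ∂μ‖ ≤ ∫ y in S, K * ‖y‖ ^ (-1 / 2 : ℝ) ∂μ := by
        refine norm_integral_le_of_norm_le ((hint.mono_set hS1).const_mul K) ?_
        filter_upwards [h0, ae_restrict_mem hS] with y hy0 hy using hf y hy hy0
    _ = K * ∫ y in S, ‖y‖ ^ (-1 / 2 : ℝ) ∂μ := integral_const_mul _ _
    _ ≤ _ := by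
        refine mul_le_mul_of_nonneg_left (setIntegral_mono_set hint ?_ hS1.eventuallyLE) hK
        exact ae_of_all _ fun y => Real.rpow_nonneg (norm_nonneg y) _

theorem norm_Ivol_le (hμ : μ {x : ℚ_[p] | ‖x‖ ≤ 1} = 1) {u : ℚ_[p] → ℂ} {M s : ℝ}
    (hM : 0 ≤ M) (hs : 0 ≤ s)
    (hu : ∀ y : ℚ_[p], y ≠ 0 → ‖y‖ ≤ 1 → ‖u y‖ ≤ M * ‖y‖ ^ (s - 1 / 4))
    {x : ℚ_[p]} (hx0 : x ≠ 0) (hx : ‖x‖ ≤ 1) :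
    ‖Ivol p μ u x‖ ≤ M * (|(1 - (p : ℝ)) / ((p : ℝ) * Real.log p)| * 4 *
      (∫ y in {y : ℚ_[p] | ‖y‖ ≤ 1}, ‖y‖ ^ (-1 / 2 : ℝ) ∂μ) * (p : ℝ)⁻¹ ^ s) *
        ‖x‖ ^ (s + 1 / 4) := by
  have hp1 := one_lt_natCast_prime (p := p)
  have hxpos : 0 < ‖x‖ := norm_pos_iff.2 hx0
  have hmeas : MeasurableSet {y : ℚ_[p] | ‖y‖ < ‖x‖} :=
    (isOpen_lt continuous_norm continuous_const).measurableSet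
  have key := norm_setIntegral_le_mul_integral_norm_rpow hμ
    (f := fun y => ((Real.log ‖x‖ - Real.log ‖y‖ : ℝ) : ℂ) * u y)
    (K := 4 * M * (p : ℝ)⁻¹ ^ s * ‖x‖ ^ (s + 1 / 4)) (by positivity) hmeas
    (fun y hy => (le_of_lt hy).trans hx) (by
      intro y hy hy0
      have hypos : 0 < ‖y‖ := norm_pos_iff.2 hy0
      have hlog : ‖((Real.log ‖x‖ - Real.log ‖y‖ : ℝ) : ℂ)‖
          ≤ 4 * (‖x‖ ^ (1 / 4 : ℝ) * ‖y‖ ^ (-1 / 4 : ℝ)) := by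
        rw [Complex.norm_real, Real.norm_of_nonneg
          (sub_nonneg.2 (Real.log_le_log hypos (le_of_lt hy))),
          ← Real.log_div hxpos.ne' hypos.ne']
        refine (Real.log_le_rpow_div (by positivity) (show (0 : ℝ) < 1 / 4 by norm_num)).trans ?_
        rw [Real.div_rpow hxpos.le hypos.le, show (-1 / 4 : ℝ) = -(1 / 4) by norm_num,
          Real.rpow_neg hypos.le]
        apply le_of_eq
        field_simp
      have hys : ‖y‖ ^ s ≤ (p : ℝ)⁻¹ ^ s * ‖x‖ ^ s := by
        rw [← Real.mul_rpow (by positivity) hxpos.le]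
        exact Real.rpow_le_rpow hypos.le (Padic.norm_le_inv_mul_of_norm_lt hy) hs
      rw [norm_mul]
      calc _ ≤ 4 * (‖x‖ ^ (1 / 4 : ℝ) * ‖y‖ ^ (-1 / 4 : ℝ)) * (M * ‖y‖ ^ (s - 1 / 4)) :=
            mul_le_mul hlog (hu y hy0 ((le_of_lt hy).trans hx)) (norm_nonneg _) (by positivity)
        _ = 4 * M * ‖x‖ ^ (1 / 4 : ℝ) * ‖y‖ ^ s * ‖y‖ ^ (-1 / 2 : ℝ) := by
            have : ‖y‖ ^ (-1 / 4 : ℝ) * ‖y‖ ^ (s - 1 / 4) = ‖y‖ ^ s * ‖y‖ ^ (-1 / 2 : ℝ) := by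
              rw [← Real.rpow_add hypos, ← Real.rpow_add hypos]
              congr 1
              ring
            linear_combination 4 * M * ‖x‖ ^ (1 / 4 : ℝ) * this
        _ ≤ 4 * M * ‖x‖ ^ (1 / 4 : ℝ) * ((p : ℝ)⁻¹ ^ s * ‖x‖ ^ s) * ‖y‖ ^ (-1 / 2 : ℝ) := by
            gcongr
        _ = _ := by
            rw [Real.rpow_add hxpos]
            ring)
  rw [Ivol, norm_mul, Complex.norm_real, Real.norm_eq_abs]
  refine (mul_le_mul_of_nonneg_left key (abs_nonneg _)).trans (le_of_eq ?_)
  ring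

end Padic

/-- The matrix elements of the characteristic function `W(z^{-1})` of `Ĩ`
are entire functions of zero order: for each `α, β ∈ {1,2}`, the series
`F_{αβ}(z) = ∑_n ⟨Ĩⁿh_α, h_β⟩ zⁿ` converges for every `z ∈ ℂ`, and for every `ε > 0` there
is `C > 0` with `|F_{αβ}(z)| ≤ C·exp(|z|^ε)` for all `z`. -/
theorem statement14
    (μ : Measure ℚ_[p]) [μ.IsAddHaarMeasure]
    (hμ : μ {x : ℚ_[p] | ‖x‖ ≤ 1} = 1) :
    ∀ a b : Fin 2,
      (∀ z : ℂ, Summable (fun n : ℕ =>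
        (∫ x in {x : ℚ_[p] | ‖x‖ ≤ 1},
            (Ivol p μ)^[n] (hFun p a) x * (starRingEnd ℂ) (hFun p b x) ∂μ) * z ^ n)) ∧
      (∀ ε : ℝ, 0 < ε → ∃ C : ℝ, 0 < C ∧ ∀ z : ℂ,
        ‖∑' n : ℕ,
            (∫ x in {x : ℚ_[p] | ‖x‖ ≤ 1},
              (Ivol p μ)^[n] (hFun p a) x * (starRingEnd ℂ) (hFun p b x) ∂μ) * z ^ n‖
          ≤ C * Real.exp (‖z‖ ^ ε)) := by
  intro a b
  have hp1 := one_lt_natCast_prime (p := p)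
  obtain ⟨M, hM, hMa⟩ := exists_norm_hFun_le (p := p) a
  obtain ⟨M', hM', hMb⟩ := exists_norm_hFun_le (p := p) b
  set L : ℝ := ∫ y in {y : ℚ_[p] | ‖y‖ ≤ 1}, ‖y‖ ^ (-1 / 2 : ℝ) ∂μ with hL
  have hL0 : 0 ≤ L := integral_nonneg fun y => by positivity
  set D : ℝ := |(1 - (p : ℝ)) / ((p : ℝ) * Real.log p)| * 4 * L with hD
  have hD0 : 0 ≤ D := by positivity
  set r : ℝ := (p : ℝ)⁻¹ ^ (1 / 2 : ℝ) with hr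
  have hr0 : 0 < r := by positivity
  have hr1 : r < 1 := Real.rpow_lt_one (by positivity) (inv_lt_one_of_one_lt₀ hp1) (by norm_num)
  let A : ℕ → ℝ := fun n => M * ∏ i ∈ Finset.range n, ((D + 1) * r ^ i)
  have hA : ∀ n, A (n + 1) = A n * ((D + 1) * r ^ n) := fun n => by
    simp only [A, Finset.prod_range_succ, mul_assoc]
  have hApos : ∀ n, 0 < A n := fun n => mul_pos hM (Finset.prod_pos fun i _ => by positivity)
  have hiter : ∀ n : ℕ, ∀ x : ℚ_[p], x ≠ 0 → ‖x‖ ≤ 1 →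
      ‖(Ivol p μ)^[n] (hFun p a) x‖ ≤ A n * ‖x‖ ^ ((n : ℝ) / 2 - 1 / 4) := by
    intro n
    induction n with
    | zero =>
      intro x hx0 hx
      refine (hMa x hx0 hx).trans (le_of_eq ?_)
      simp [A, neg_div]
    | succ n ih =>
      intro x hx0 hx
      rw [Function.iterate_succ_apply']
      have h := norm_Ivol_le hμ (hApos n).le (by positivity) ih hx0 hx
      have hrn : (p : ℝ)⁻¹ ^ ((n : ℝ) / 2) = r ^ n := by
        rw [hr, ← Real.rpow_natCast, ← Real.rpow_mul (by positivity)]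
        congr 1
        ring
      have hexp : ((n + 1 : ℕ) : ℝ) / 2 - 1 / 4 = (n : ℝ) / 2 + 1 / 4 := by
        push_cast
        ring
      rw [hrn, ← hL, ← hD] at h
      rw [hexp, hA]
      refine h.trans ?_
      have := (hApos n).le
      gcongr
      linarith
  refine summable_and_zero_order_of_norm_le (A := fun n => A n * (M' * (L + 1))) (D := D + 1)
    (by positivity) hr0 hr1 (by have := hApos 0; positivity)
    (fun n => by rw [hA]; ring) fun n => ?_
  have hAn := hApos n
  refine (norm_setIntegral_le_mul_integral_norm_rpow hμ (K := A n * M') (by positivity)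
    (measurableSet_norm_le 1) le_rfl fun x hx hx0 => ?_).trans ?_
  · have hxpos : 0 < ‖x‖ := norm_pos_iff.2 hx0
    rw [norm_mul, RCLike.norm_conj]
    calc _ ≤ A n * ‖x‖ ^ ((n : ℝ) / 2 - 1 / 4) * (M' * ‖x‖ ^ (-1 / 4 : ℝ)) :=
          mul_le_mul (hiter n x hx0 hx) (hMb x hx0 hx) (norm_nonneg _) (by positivity)
      _ = A n * M' * ‖x‖ ^ ((n : ℝ) / 2 - 1 / 4 + -1 / 4) := by
          rw [Real.rpow_add hxpos]
          ring
      _ ≤ A n * M' * ‖x‖ ^ (-1 / 2 : ℝ) := by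
          refine mul_le_mul_of_nonneg_left ?_ (by positivity)
          refine Real.rpow_le_rpow_of_exponent_ge hxpos hx ?_
          have : (0 : ℝ) ≤ n := n.cast_nonneg
          linarith
  · rw [← hL, mul_assoc]
    gcongr
    linarith
end
end

section
/- For every n ∈ ℤ, the Laplace-type transform satisfies the difference identity Φ(n) − Φ(n+1) = p^{-n} [ ψ(−n) − ψ(−n+1) ]. -/
open MeasureTheory Complex

noncomputable section

variable (p : ℕ) [Fact p.Prime] [MeasurableSpace ℚ_[p]] [BorelSpace ℚ_[p]]

/-- The radial function `v_0`: equal to `1` for `‖z‖ ≤ 1`, to `−1/(p−1)` for `‖z‖ = p`,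
and to `0` for `‖z‖ ≥ p²`. -/
def v0 (z : ℚ_[p]) : ℂ :=
  if ‖z‖ ≤ 1 then 1
  else if ‖z‖ = (p : ℝ) then -1 / ((p : ℂ) - 1)
  else 0

/-- The Laplace-type transform `φ̃(ξ) = ∫_{ℚ_p} v_0(xξ) φ(x) dμ(x)`. -/
def laplace (μ : Measure ℚ_[p]) (φ : ℚ_[p] → ℂ) (ξ : ℚ_[p]) : ℂ :=
  ∫ x, v0 p (x * ξ) * φ x ∂μ

/-- `Φ(n)`: the value of the Laplace-type transform at any `ξ` with `‖ξ‖ = pⁿ`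
(here taken at `ξ = p^{-n}`, which has norm `pⁿ`). -/
def Phi (μ : Measure ℚ_[p]) (φ : ℚ_[p] → ℂ) (n : ℤ) : ℂ :=
  laplace p μ φ ((p : ℚ_[p]) ^ (-n))

/-- Each closed ball of radius `p ^ (k + 1)` splits into `p` translates of the ball of radius
`p ^ k`. -/
lemma closedBall_zpow_succ_eq_iUnion (p : ℕ) [Fact p.Prime] (k : ℤ) :
    Metric.closedBall (0 : ℚ_[p]) ((p : ℝ) ^ (k + 1)) =
      ⋃ i : Fin p, Metric.closedBall ((i : ℚ_[p]) * (p : ℚ_[p]) ^ (-(k + 1))) ((p : ℝ) ^ k) := by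
  have hp := (Fact.out : p.Prime)
  have hp0 : (p : ℚ_[p]) ≠ 0 := mod_cast hp.ne_zero
  have hpr : (0 : ℝ) < p := mod_cast hp.pos
  ext x
  simp only [Set.mem_iUnion, mem_closedBall_iff_norm, sub_zero]
  constructor
  · intro hx
    have hy : ‖x * (p : ℚ_[p]) ^ (k + 1)‖ ≤ 1 := by
      rw [norm_mul, Padic.norm_p_zpow, zpow_neg, ← div_eq_mul_inv]
      exact (div_le_one (zpow_pos hpr _)).2 hx
    obtain ⟨n, hn, hxn⟩ := PadicInt.exists_mem_range (⟨_, hy⟩ : ℤ_[p])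
    rw [IsLocalRing.mem_maximalIdeal, PadicInt.mem_nonunits, PadicInt.norm_def] at hxn
    refine ⟨⟨n, hn⟩, ?_⟩
    rw [Padic.norm_le_pow_iff_norm_lt_pow_add_one]
    have : x - (n : ℚ_[p]) * (p : ℚ_[p]) ^ (-(k + 1)) =
        (x * (p : ℚ_[p]) ^ (k + 1) - n) * (p : ℚ_[p]) ^ (-(k + 1)) := by
      rw [sub_mul, mul_assoc, ← zpow_add₀ hp0, add_neg_cancel, zpow_zero, mul_one]
    rw [this, norm_mul, Padic.norm_p_zpow, neg_neg]
    exact mul_lt_of_lt_one_left (zpow_pos hpr _) hxn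
  · rintro ⟨i, hi⟩
    rw [← sub_add_cancel x ((i : ℚ_[p]) * (p : ℚ_[p]) ^ (-(k + 1)))]
    refine (Padic.nonarchimedean _ _).trans (max_le (hi.trans ?_) ?_)
    · exact zpow_le_zpow_right₀ (mod_cast hp.one_le) (by lia)
    · rw [norm_mul, Padic.norm_p_zpow, neg_neg]
      exact mul_le_of_le_one_left (zpow_pos hpr _).le (mod_cast Padic.norm_int_le_one (i : ℤ))

lemma pairwise_disjoint_closedBall_zpow (p : ℕ) [Fact p.Prime] (k : ℤ) :
    Pairwise (Function.onFun Disjoint fun i : Fin p =>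
      Metric.closedBall ((i : ℚ_[p]) * (p : ℚ_[p]) ^ (-(k + 1))) ((p : ℝ) ^ k)) := by
  intro i j hij
  refine Set.disjoint_left.2 fun x hi hj => hij ?_
  rw [mem_closedBall_iff_norm, ← norm_neg, neg_sub] at hi
  rw [mem_closedBall_iff_norm] at hj
  have h := (Padic.nonarchimedean _ _).trans (max_le hi hj)
  rw [sub_add_sub_cancel, ← sub_mul, norm_mul, Padic.norm_p_zpow, neg_neg] at h
  have hlt : (p : ℝ) ^ k < (p : ℝ) ^ (k + 1) :=
    zpow_lt_zpow_right₀ (mod_cast (Fact.out : p.Prime).one_lt) (lt_add_one k)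
  have h1 : ‖(i : ℚ_[p]) - (j : ℚ_[p])‖ < 1 :=
    lt_of_mul_lt_mul_right ((h.trans_lt hlt).trans_eq (one_mul _).symm) (by positivity)
  have hdvd : (p : ℤ) ∣ (i : ℤ) - (j : ℤ) := by
    rw [← Padic.norm_intCast_lt_one_iff]
    push_cast
    exact h1
  have hsub := Int.eq_zero_of_abs_lt_dvd hdvd (by
    have := i.isLt
    have := j.isLt
    rw [abs_lt]
    constructor <;> omega)
  exact Fin.ext (by omega)

lemma measure_closedBall_zpow_succ (μ : Measure ℚ_[p]) [μ.IsAddHaarMeasure] (k : ℤ) :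
    μ (Metric.closedBall 0 ((p : ℝ) ^ (k + 1))) = p * μ (Metric.closedBall 0 ((p : ℝ) ^ k)) := by
  rw [closedBall_zpow_succ_eq_iUnion, measure_iUnion (pairwise_disjoint_closedBall_zpow p k)
    fun _ => Metric.isClosed_closedBall.measurableSet]
  have h (a : ℚ_[p]) :
      μ (Metric.closedBall a ((p : ℝ) ^ k)) = μ (Metric.closedBall 0 ((p : ℝ) ^ k)) := by
    rw [← measure_preimage_add_right μ (-a) (Metric.closedBall 0 _)]
    congr 1
    ext x
    simp only [Set.mem_preimage, mem_closedBall_iff_norm, sub_eq_add_neg, neg_zero, add_zero]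
  simp [h]

lemma measureReal_closedBall_zpow (μ : Measure ℚ_[p]) [μ.IsAddHaarMeasure]
    (hμ : μ {x : ℚ_[p] | ‖x‖ ≤ 1} = 1) (k : ℤ) :
    μ.real (Metric.closedBall 0 ((p : ℝ) ^ k)) = (p : ℝ) ^ k := by
  have hp0 : (p : ℝ) ≠ 0 := mod_cast (Fact.out : p.Prime).ne_zero
  have hsucc (k : ℤ) : μ.real (Metric.closedBall 0 ((p : ℝ) ^ (k + 1))) =
      p * μ.real (Metric.closedBall 0 ((p : ℝ) ^ k)) := by
    simp [Measure.real, measure_closedBall_zpow_succ]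
  induction k using Int.induction_on with
  | zero =>
    have : Metric.closedBall (0 : ℚ_[p]) ((p : ℝ) ^ (0 : ℤ)) = {x | ‖x‖ ≤ 1} := by ext; simp
    rw [this, Measure.real, hμ]
    simp
  | succ k ih => rw [hsucc, ih, zpow_add_one₀ hp0, mul_comm]
  | pred k ih =>
    have h := hsucc (-k - 1)
    rw [sub_add_cancel, ih] at h
    exact mul_left_cancel₀ hp0 (by rw [← h, ← zpow_one_add₀ hp0, add_sub_cancel])

lemma closedBall_zpow_eq_union_sphere (p : ℕ) [Fact p.Prime] (k : ℤ) :
    Metric.closedBall (0 : ℚ_[p]) ((p : ℝ) ^ k) =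
      Metric.closedBall 0 ((p : ℝ) ^ (k - 1)) ∪ Metric.sphere 0 ((p : ℝ) ^ k) := by
  ext x
  rw [Set.mem_union, mem_closedBall_iff_norm, mem_closedBall_iff_norm, mem_sphere_iff_norm,
    sub_zero, ← Padic.norm_lt_pow_iff_norm_le_pow_sub_one, le_iff_lt_or_eq]

lemma disjoint_closedBall_zpow_sphere (p : ℕ) [Fact p.Prime] (k : ℤ) :
    Disjoint (Metric.closedBall (0 : ℚ_[p]) ((p : ℝ) ^ (k - 1)))
      (Metric.sphere 0 ((p : ℝ) ^ k)) := by
  refine Set.disjoint_left.2 fun x hx hx' => ?_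
  rw [mem_closedBall_iff_norm, sub_zero, ← Padic.norm_lt_pow_iff_norm_le_pow_sub_one] at hx
  rw [mem_sphere_iff_norm, sub_zero] at hx'
  exact hx.ne hx'

lemma measureReal_sphere_zpow (μ : Measure ℚ_[p]) [μ.IsAddHaarMeasure]
    (hμ : μ {x : ℚ_[p] | ‖x‖ ≤ 1} = 1) (k : ℤ) :
    μ.real (Metric.sphere 0 ((p : ℝ) ^ k)) = (p : ℝ) ^ k - (p : ℝ) ^ (k - 1) := by
  have h := measureReal_union (μ := μ) (disjoint_closedBall_zpow_sphere p k)
    Metric.isClosed_sphere.measurableSet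
    (isCompact_closedBall _ _).measure_ne_top (isCompact_sphere _ _).measure_ne_top
  rw [← closedBall_zpow_eq_union_sphere, measureReal_closedBall_zpow p μ hμ,
    measureReal_closedBall_zpow p μ hμ] at h
  linarith

lemma closedBall_zpow_eq_singleton_union_iUnion_sphere (p : ℕ) [Fact p.Prime] (K : ℤ) :
    Metric.closedBall (0 : ℚ_[p]) ((p : ℝ) ^ K) =
      {0} ∪ ⋃ n : ℕ, Metric.sphere 0 ((p : ℝ) ^ (K - (n : ℤ))) := by
  have hp1 : (1 : ℝ) < p := mod_cast (Fact.out : p.Prime).one_lt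
  ext x
  simp only [Set.mem_union, Set.mem_iUnion, Set.mem_singleton_iff, mem_closedBall_iff_norm,
    mem_sphere_iff_norm, sub_zero]
  constructor
  · intro hx
    by_cases h0 : x = 0
    · exact .inl h0
    rw [Padic.norm_eq_zpow_neg_valuation h0] at hx ⊢
    have := (zpow_le_zpow_iff_right₀ hp1).1 hx
    exact .inr ⟨(K + x.valuation).toNat, by congr 1; lia⟩
  · rintro (rfl | ⟨n, hn⟩)
    · simp; positivity
    · exact hn.trans_le (zpow_le_zpow_right₀ hp1.le (by lia))

section Radial

variable {p} {μ : Measure ℚ_[p]} [μ.IsAddHaarMeasure] {φ : ℚ_[p] → ℂ} {ψ : ℤ → ℂ}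

lemma integrableOn_sphere_of_radial
    (hψ : ∀ (x : ℚ_[p]) (k : ℤ), ‖x‖ = (p : ℝ) ^ k → φ x = ψ k) (k : ℤ) :
    IntegrableOn φ (Metric.sphere 0 ((p : ℝ) ^ k)) μ :=
  (integrableOn_const (C := ψ k) (isCompact_sphere _ _).measure_ne_top).congr_fun
    (fun x hx => (hψ x k (by simpa using hx)).symm) Metric.isClosed_sphere.measurableSet

lemma setIntegral_sphere_of_radial (hμ : μ {x : ℚ_[p] | ‖x‖ ≤ 1} = 1)
    (hψ : ∀ (x : ℚ_[p]) (k : ℤ), ‖x‖ = (p : ℝ) ^ k → φ x = ψ k) (k : ℤ) :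
    ∫ x in Metric.sphere 0 ((p : ℝ) ^ k), φ x ∂μ =
      ((p : ℝ) ^ k - (p : ℝ) ^ (k - 1) : ℝ) * ψ k := by
  rw [setIntegral_congr_fun Metric.isClosed_sphere.measurableSet
    (fun x hx => hψ x k (by simpa using hx)), setIntegral_const,
    measureReal_sphere_zpow p μ hμ, Complex.real_smul]

lemma integrableOn_closedBall_of_radial (hμ : μ {x : ℚ_[p] | ‖x‖ ≤ 1} = 1)
    (hψ : ∀ (x : ℚ_[p]) (k : ℤ), ‖x‖ = (p : ℝ) ^ k → φ x = ψ k) {K : ℤ}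
    (hint : Summable (fun n : ℕ => (p : ℝ) ^ (K - (n : ℤ)) * ‖ψ (K - (n : ℤ))‖)) :
    IntegrableOn φ (Metric.closedBall 0 ((p : ℝ) ^ K)) μ := by
  rw [closedBall_zpow_eq_singleton_union_iUnion_sphere]
  refine (integrableOn_singleton (by finiteness) isCompact_singleton.measure_lt_top).union
    (integrableOn_iUnion_of_summable_integral_norm
      (fun n => integrableOn_sphere_of_radial hψ _)
      (hint.of_nonneg_of_le (fun n => integral_nonneg fun x => norm_nonneg _) fun n => ?_))
  rw [setIntegral_congr_fun (g := fun _ => ‖ψ (K - n)‖) Metric.isClosed_sphere.measurableSet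
    (fun x hx => congrArg norm (hψ x _ (by simpa using hx))), setIntegral_const,
    measureReal_sphere_zpow p μ hμ, smul_eq_mul]
  gcongr
  exact sub_le_self _ (by positivity)

lemma v0_mul_zpow_mul_eq_indicator {p : ℕ} [Fact p.Prime]
    (φ : ℚ_[p] → ℂ) (n : ℤ) (x : ℚ_[p]) :
    v0 p (x * (p : ℚ_[p]) ^ (-n)) * φ x =
      (Metric.closedBall 0 ((p : ℝ) ^ (-n))).indicator φ x +
        -1 / ((p : ℂ) - 1) * (Metric.sphere 0 ((p : ℝ) ^ (-n + 1))).indicator φ x := by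
  classical
  have hp1 : (1 : ℝ) < p := mod_cast (Fact.out : p.Prime).one_lt
  have hpos : 0 < (p : ℝ) ^ n := by positivity
  have hle : ‖x * (p : ℚ_[p]) ^ (-n)‖ ≤ 1 ↔ ‖x‖ ≤ (p : ℝ) ^ (-n) := by
    rw [norm_mul, Padic.norm_p_zpow, neg_neg, zpow_neg, ← one_div, le_div_iff₀ hpos]
  have heq : ‖x * (p : ℚ_[p]) ^ (-n)‖ = p ↔ ‖x‖ = (p : ℝ) ^ (-n + 1) := by
    rw [norm_mul, Padic.norm_p_zpow, neg_neg, zpow_add_one₀ (by positivity), zpow_neg,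
      mul_comm _ (p : ℝ), ← div_eq_mul_inv, eq_div_iff hpos.ne']
  have hlt : (p : ℝ) ^ (-n) < (p : ℝ) ^ (-n + 1) := zpow_lt_zpow_right₀ hp1 (by lia)
  simp only [v0, hle, heq, Set.indicator_apply, mem_closedBall_iff_norm, mem_sphere_iff_norm,
    sub_zero]
  split_ifs <;> first | linarith | simp

lemma Phi_eq_setIntegral_add (hμ : μ {x : ℚ_[p] | ‖x‖ ≤ 1} = 1)
    (hψ : ∀ (x : ℚ_[p]) (k : ℤ), ‖x‖ = (p : ℝ) ^ k → φ x = ψ k) {n : ℤ}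
    (hφ : IntegrableOn φ (Metric.closedBall 0 ((p : ℝ) ^ (-n))) μ) :
    Phi p μ φ n = (∫ x in Metric.closedBall 0 ((p : ℝ) ^ (-n)), φ x ∂μ) +
      -(((p : ℝ) ^ (-n) : ℝ) : ℂ) * ψ (-n + 1) := by
  have hp0 : (p : ℂ) ≠ 0 := mod_cast (Fact.out : p.Prime).ne_zero
  have hp1 : (p : ℂ) - 1 ≠ 0 := sub_ne_zero.2 (mod_cast (Fact.out : p.Prime).ne_one)
  have hB : MeasurableSet (Metric.closedBall (0 : ℚ_[p]) ((p : ℝ) ^ (-n))) :=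
    Metric.isClosed_closedBall.measurableSet
  have hS : MeasurableSet (Metric.sphere (0 : ℚ_[p]) ((p : ℝ) ^ (-n + 1))) :=
    Metric.isClosed_sphere.measurableSet
  simp only [Phi, laplace, v0_mul_zpow_mul_eq_indicator]
  rw [integral_add (hφ.integrable_indicator hB)
    (((integrableOn_sphere_of_radial hψ _).integrable_indicator hS).const_mul _),
    integral_const_mul, integral_indicator hB, integral_indicator hS,
    setIntegral_sphere_of_radial hμ hψ, add_sub_cancel_right]
  push_cast
  rw [zpow_add_one₀ hp0]
  field_simp

end Radial

/-- The difference identity for the Laplace-type transform: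
`Φ(n) − Φ(n+1) = p^{-n}[ψ(−n) − ψ(−n+1)]` for every `n ∈ ℤ`. -/
theorem statement16
    (μ : Measure ℚ_[p]) [μ.IsAddHaarMeasure]
    (hμ : μ {x : ℚ_[p] | ‖x‖ ≤ 1} = 1)
    (φ : ℚ_[p] → ℂ) (ψ : ℤ → ℂ)
    (hψ : ∀ (x : ℚ_[p]) (k : ℤ), ‖x‖ = (p : ℝ) ^ k → φ x = ψ k)
    (hint : ∀ K : ℤ, Summable (fun n : ℕ => (p : ℝ) ^ (K - (n : ℤ)) * ‖ψ (K - (n : ℤ))‖)) :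
    ∀ n : ℤ, Phi p μ φ n - Phi p μ φ (n + 1)
      = (((p : ℝ) ^ (-n) : ℝ) : ℂ) * (ψ (-n) - ψ (-n + 1)) := by
  intro n
  have hB (K : ℤ) := integrableOn_closedBall_of_radial hμ hψ (hint K)
  have hp0 : (p : ℝ) ≠ 0 := mod_cast (Fact.out : p.Prime).ne_zero
  rw [Phi_eq_setIntegral_add hμ hψ (hB _), Phi_eq_setIntegral_add hμ hψ (hB _),
    closedBall_zpow_eq_union_sphere p (-n), setIntegral_union (disjoint_closedBall_zpow_sphere p _)
      Metric.isClosed_sphere.measurableSet (hB _) (integrableOn_sphere_of_radial hψ _),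
    setIntegral_sphere_of_radial hμ hψ, show -(n + 1) = -n - 1 by ring, sub_add_cancel]
  push_cast
  ring
end
end
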